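/- arXiv:2512.04530 — 2 statements merged into one kernel-verified Lean document; each statement's English description precedes it below -/
import Mathlib

section
/- Suppose A ∈ ℝ^{n×n} is a symmetric matrix with nonnegative entries whose minimum node degree is at least α ≥ 0 and which satisfies ‖A‖₂ ≤ β_A, and let Δ_A ∈ ℝ^{n×n} be a symmetric perturbation with κ = min_i ∑_j (Δ_A)_{ij} satisfying 1 + α + κ > 0. Then the perturbed normalized self-connected adjacency matrix Ũ = D̂′^{−1/2} Â′ D̂′^{−1/2} satisfies ‖Ũ‖₂ ≤ (1 + α + κ)^{−1} (1 + β_A + ‖Δ_A‖₂). -/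
open Matrix BigOperators Finset

noncomputable def specNorm {m n : Type*} [Fintype m] [Fintype n] [DecidableEq n]
    (A : Matrix m n ℝ) : ℝ :=
  ‖LinearMap.toContinuousLinearMap (Matrix.toEuclideanLin A)‖

noncomputable def frobNorm {m n : Type*} [Fintype m] [Fintype n] (A : Matrix m n ℝ) : ℝ :=
  Real.sqrt (∑ i, ∑ j, (A i j) ^ 2)

noncomputable def vecNorm {ι : Type*} [Fintype ι] (v : ι → ℝ) : ℝ :=
  Real.sqrt (∑ i, (v i) ^ 2)

noncomputable def normAdj {v : Type*} [Fintype v] [DecidableEq v]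
    (A : Matrix v v ℝ) : Matrix v v ℝ :=
  Matrix.diagonal (fun i => (Real.sqrt (∑ j, (1 + A) i j))⁻¹) * (1 + A) *
    Matrix.diagonal (fun i => (Real.sqrt (∑ j, (1 + A) i j))⁻¹)

noncomputable def deltaD {v : Type*} [Fintype v] [DecidableEq v]
    (A ΔA : Matrix v v ℝ) : Matrix v v ℝ :=
  1 - Matrix.diagonal (fun i => Real.sqrt (∑ j, (1 + (A + ΔA)) i j)) *
      Matrix.diagonal (fun i => (Real.sqrt (∑ j, (1 + A) i j))⁻¹)

noncomputable def gcn {v : Type*} [Fintype v] (U : Matrix v v ℝ) (σ : ℝ → ℝ)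
    {d : ℕ → ℕ} (W : (l : ℕ) → Matrix (Fin (d l)) (Fin (d (l + 1))) ℝ)
    (X0 : Matrix v (Fin (d 0)) ℝ) : (l : ℕ) → Matrix v (Fin (d l)) ℝ
  | 0 => X0
  | l + 1 => (U * gcn U σ W X0 l * W l).map σ

noncomputable def avgPool {v p : Type*} [Fintype v] [Fintype p]
    (X : Matrix v p ℝ) : p → ℝ :=
  fun j => (∑ i, X i j) / (Fintype.card v : ℝ)

noncomputable def ensembleRep {n M : ℕ} {d : ℕ → ℕ} (A : Matrix (Fin n) (Fin n) ℝ)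
    (σ : ℝ → ℝ) (W : Fin M → (l : ℕ) → Matrix (Fin (d l)) (Fin (d (l + 1))) ℝ)
    (X : Matrix (Fin n) (Fin (d 0)) ℝ) (lam : Fin M → ℝ) (L : ℕ) : Fin (d L) → ℝ :=
  fun j => ∑ m, lam m * avgPool (gcn (normAdj A) σ (W m) X L) j

def principalSub {n : ℕ} (A : Matrix (Fin n) (Fin n) ℝ) (s : Finset (Fin n)) :
    Matrix s s ℝ :=
  A.submatrix (fun i => (i : Fin n)) (fun j => (j : Fin n))

def rowSub {n p : ℕ} (X : Matrix (Fin n) (Fin p) ℝ) (s : Finset (Fin n)) :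
    Matrix s (Fin p) ℝ :=
  X.submatrix (fun i => (i : Fin n)) id

open scoped Matrix.Norms.L2Operator in
theorem specNorm_eq_l2_opNorm {v : Type*} [Fintype v] [DecidableEq v] (M : Matrix v v ℝ) :
    specNorm M = ‖M‖ := rfl

open scoped Matrix.Norms.L2Operator in
theorem specNorm_one_add_add_le {v : Type*} [Fintype v] [DecidableEq v] (A B : Matrix v v ℝ) :
    specNorm (1 + (A + B)) ≤ 1 + specNorm A + specNorm B := by
  have h1 : ‖(1 : Matrix v v ℝ)‖ ≤ 1 := by
    rw [← Matrix.diagonal_one, Matrix.l2_opNorm_diagonal]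
    exact (pi_norm_le_iff_of_nonneg zero_le_one).2 fun i => by simp
  simp only [specNorm_eq_l2_opNorm]
  linarith [norm_add_le 1 (A + B), norm_add_le A B]

open scoped Matrix.Norms.L2Operator in
/-- A lower bound `c` on the self-connected degrees bounds the spectral norm of the
normalized adjacency matrix. -/
theorem specNorm_normAdj_le {v : Type*} [Fintype v] [DecidableEq v] (A : Matrix v v ℝ) {c : ℝ}
    (hc : 0 < c) (hdeg : ∀ i, c ≤ ∑ j, (1 + A) i j) :
    specNorm (normAdj A) ≤ c⁻¹ * specNorm (1 + A) := by
  simp only [specNorm_eq_l2_opNorm, normAdj]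
  set d : v → ℝ := fun i => (Real.sqrt (∑ j, (1 + A) i j))⁻¹
  have hd : ‖Matrix.diagonal d‖ ≤ (Real.sqrt c)⁻¹ := by
    rw [Matrix.l2_opNorm_diagonal]
    refine (pi_norm_le_iff_of_nonneg (by positivity)).2 fun i => ?_
    rw [Real.norm_of_nonneg (by positivity)]
    exact inv_anti₀ (Real.sqrt_pos.2 hc) (Real.sqrt_le_sqrt (hdeg i))
  calc ‖Matrix.diagonal d * (1 + A) * Matrix.diagonal d‖
      ≤ ‖Matrix.diagonal d‖ * ‖1 + A‖ * ‖Matrix.diagonal d‖ := norm_mul₃_le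
    _ ≤ (Real.sqrt c)⁻¹ * ‖1 + A‖ * (Real.sqrt c)⁻¹ := by gcongr
    _ = (Real.sqrt c * Real.sqrt c)⁻¹ * ‖1 + A‖ := by rw [mul_inv]; ring
    _ = c⁻¹ * ‖1 + A‖ := by rw [Real.mul_self_sqrt hc.le]

theorem spec_norm_perturbed_normAdj_le {n : ℕ} (hn : 0 < n)
    (A ΔA : Matrix (Fin n) (Fin n) ℝ) (α βA κ : ℝ)
    (hsymm : A.IsSymm) (hnonneg : ∀ i j, 0 ≤ A i j)
    (hα : 0 ≤ α) (hdeg : ∀ i, α ≤ ∑ j, A i j) (hA : specNorm A ≤ βA)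
    (hΔsymm : ΔA.IsSymm) (hκ : κ = ⨅ i, ∑ j, ΔA i j) (hpos : 0 < 1 + α + κ) :
    specNorm (normAdj (A + ΔA)) ≤ (1 + α + κ)⁻¹ * (1 + βA + specNorm ΔA) := by
  have hdeg' : ∀ i, 1 + α + κ ≤ ∑ j, (1 + (A + ΔA)) i j := fun i => by
    have hκi : κ ≤ ∑ j, ΔA i j :=
      hκ ▸ ciInf_le (Set.finite_range fun i => ∑ j, ΔA i j).bddBelow i
    have hsum : ∑ j, (1 + (A + ΔA)) i j = 1 + (∑ j, A i j + ∑ j, ΔA i j) := by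
      simp [Matrix.add_apply, Finset.sum_add_distrib, Matrix.one_apply]
    linarith [hdeg i]
  refine (specNorm_normAdj_le (A + ΔA) hpos hdeg').trans ?_
  gcongr
  linarith [specNorm_one_add_add_le A ΔA]
end

section
/- Suppose A ∈ ℝ^{n×n} is symmetric with nonnegative entries, has minimum node degree at least α ≥ 0, and satisfies ‖A‖₂ ≤ β_A; let Δ_A ∈ ℝ^{n×n} be a symmetric perturbation with κ = min_i ∑_j (Δ_A)_{ij} ≥ 0. Then the difference of normalized self-connected adjacency matrices satisfies ‖Ũ − U‖₂ ≤ 2 (1 + β_A)(1 + α)^{−1} ‖Δ_D‖₂ + (1 + α + κ)^{−1} ‖Δ_A‖₂, where Δ_D = I − D̂′^{1/2} D̂^{−1/2}. -/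
open Matrix BigOperators Finset

section SpecNorm

variable {l m n : Type*} [Fintype l] [Fintype m] [Fintype n] [DecidableEq n]

open scoped Matrix.Norms.L2Operator

lemma specNorm_eq_l2_opNorm_s2 (A : Matrix m n ℝ) : specNorm A = ‖A‖ :=
  (Matrix.l2_opNorm_def A).symm

lemma specNorm_nonneg (A : Matrix m n ℝ) : 0 ≤ specNorm A :=
  norm_nonneg _

lemma specNorm_add_le (A B : Matrix m n ℝ) : specNorm (A + B) ≤ specNorm A + specNorm B := by
  simpa only [specNorm_eq_l2_opNorm_s2] using norm_add_le A B

lemma specNorm_mul_le [DecidableEq m] (A : Matrix l m ℝ) (B : Matrix m n ℝ) :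
    specNorm (A * B) ≤ specNorm A * specNorm B := by
  simpa only [specNorm_eq_l2_opNorm_s2] using Matrix.l2_opNorm_mul A B

lemma specNorm_diagonal_le {d : n → ℝ} {c : ℝ} (hc : 0 ≤ c) (hd : ∀ i, |d i| ≤ c) :
    specNorm (Matrix.diagonal d) ≤ c := by
  rw [specNorm_eq_l2_opNorm_s2, Matrix.l2_opNorm_diagonal]
  exact (pi_norm_le_iff_of_nonneg hc).2 hd

lemma specNorm_diagonal_inv_sqrt_le {d : n → ℝ} {c : ℝ} (hc : 0 < c) (hd : ∀ i, c ≤ d i) :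
    specNorm (Matrix.diagonal fun i => (Real.sqrt (d i))⁻¹) ≤ (Real.sqrt c)⁻¹ := by
  refine specNorm_diagonal_le (by positivity) fun i => ?_
  rw [abs_of_nonneg (by positivity)]
  exact inv_anti₀ (Real.sqrt_pos.2 hc) (Real.sqrt_le_sqrt (hd i))

lemma specNorm_one_le : specNorm (1 : Matrix n n ℝ) ≤ 1 := by
  rw [← Matrix.diagonal_one]
  exact specNorm_diagonal_le zero_le_one fun _ => by simp

lemma specNorm_mul_mul_le {A B C : Matrix n n ℝ} {a b c : ℝ}
    (hA : specNorm A ≤ a) (hB : specNorm B ≤ b) (hC : specNorm C ≤ c) :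
    specNorm (A * B * C) ≤ a * b * c := by
  have ha := (specNorm_nonneg A).trans hA
  have hb := (specNorm_nonneg B).trans hB
  calc specNorm (A * B * C) ≤ specNorm (A * B) * specNorm C := specNorm_mul_le _ _
    _ ≤ a * b * c := mul_le_mul
        ((specNorm_mul_le A B).trans (mul_le_mul hA hB (specNorm_nonneg B) ha))
        hC (specNorm_nonneg C) (mul_nonneg ha hb)

end SpecNorm

lemma sum_one_add_apply {n : Type*} [Fintype n] [DecidableEq n] (A : Matrix n n ℝ) (i : n) :
    ∑ j, (1 + A) i j = 1 + ∑ j, A i j := by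
  simp [Finset.sum_add_distrib, Matrix.one_apply]

theorem spec_norm_normAdj_diff_le {n : ℕ} (hn : 0 < n)
    (A ΔA : Matrix (Fin n) (Fin n) ℝ) (α βA κ : ℝ)
    (hsymm : A.IsSymm) (hnonneg : ∀ i j, 0 ≤ A i j)
    (hα : 0 ≤ α) (hdeg : ∀ i, α ≤ ∑ j, A i j) (hA : specNorm A ≤ βA)
    (hΔsymm : ΔA.IsSymm) (hκ : κ = ⨅ i, ∑ j, ΔA i j) (hκ0 : 0 ≤ κ) :
    specNorm (normAdj (A + ΔA) - normAdj A) ≤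
      2 * (1 + βA) * (1 + α)⁻¹ * specNorm (deltaD A ΔA)
        + (1 + α + κ)⁻¹ * specNorm ΔA := by
  have hκi : ∀ i, κ ≤ ∑ j, ΔA i j := fun i => by
    rw [hκ]; exact ciInf_le (Set.finite_range _).bddBelow i
  have hd : ∀ i, 1 + α ≤ ∑ j, (1 + A) i j := fun i => by
    rw [sum_one_add_apply]; linarith [hdeg i]
  have hd' : ∀ i, 1 + α + κ ≤ ∑ j, (1 + (A + ΔA)) i j := fun i => by
    rw [sum_one_add_apply]
    simp only [Matrix.add_apply, Finset.sum_add_distrib]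
    linarith [hdeg i, hκi i]
  have hQ := specNorm_diagonal_inv_sqrt_le (by linarith) hd
  have hPκ := specNorm_diagonal_inv_sqrt_le (by linarith) hd'
  have hP := specNorm_diagonal_inv_sqrt_le (c := 1 + α) (by linarith)
    fun i => (le_add_of_nonneg_right hκ0).trans (hd' i)
  have hE : Matrix.diagonal (fun i => (Real.sqrt (∑ j, (1 + (A + ΔA)) i j))⁻¹) * deltaD A ΔA =
      Matrix.diagonal (fun i => (Real.sqrt (∑ j, (1 + (A + ΔA)) i j))⁻¹) -
        Matrix.diagonal (fun i => (Real.sqrt (∑ j, (1 + A) i j))⁻¹) := by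
    have hs : ∀ i, Real.sqrt (∑ j, (1 + (A + ΔA)) i j) ≠ 0 := fun i =>
      (Real.sqrt_pos.2 (by linarith [hd' i])).ne'
    rw [deltaD, mul_sub, mul_one, ← mul_assoc, Matrix.diagonal_mul_diagonal]
    simp only [inv_mul_cancel₀ (hs _), Matrix.diagonal_one, one_mul]
  have hE' : deltaD A ΔA * Matrix.diagonal (fun i => (Real.sqrt (∑ j, (1 + (A + ΔA)) i j))⁻¹) =
      Matrix.diagonal (fun i => (Real.sqrt (∑ j, (1 + (A + ΔA)) i j))⁻¹) -
        Matrix.diagonal (fun i => (Real.sqrt (∑ j, (1 + A) i j))⁻¹) := by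
    rw [← hE, deltaD]
    simp only [sub_mul, mul_sub, one_mul, mul_one, Matrix.diagonal_mul_diagonal]
    congr 2
    ext i
    ring
  rw [normAdj, normAdj]
  set P := Matrix.diagonal (fun i => (Real.sqrt (∑ j, (1 + (A + ΔA)) i j))⁻¹)
  set Q := Matrix.diagonal (fun i => (Real.sqrt (∑ j, (1 + A) i j))⁻¹)
  set E := deltaD A ΔA
  have hA1 : specNorm (1 + A) ≤ 1 + βA :=
    (specNorm_add_le 1 A).trans (add_le_add specNorm_one_le hA)
  have key : P * (1 + (A + ΔA)) * P - Q * (1 + A) * Q =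
      E * (P * (1 + A) * P) + Q * (1 + A) * P * E + P * ΔA * P := by
    calc _ = (P - Q) * (1 + A) * P + Q * (1 + A) * (P - Q) + P * ΔA * P := by noncomm_ring
      _ = (E * P) * (1 + A) * P + Q * (1 + A) * (P * E) + P * ΔA * P := by rw [hE, hE']
      _ = _ := by simp only [mul_assoc]
  have inv_sqrt_mul : ∀ b c : ℝ, 0 ≤ c →
      (Real.sqrt c)⁻¹ * b * (Real.sqrt c)⁻¹ = b * c⁻¹ := fun b c hc => by
    rw [mul_right_comm, ← mul_inv, Real.mul_self_sqrt hc, mul_comm]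
  have h₁ := specNorm_mul_mul_le hP hA1 hP
  have h₂ := specNorm_mul_mul_le hQ hA1 hP
  have h₃ := specNorm_mul_mul_le hPκ (le_refl (specNorm ΔA)) hPκ
  rw [inv_sqrt_mul _ _ (by linarith)] at h₁ h₂ h₃
  have hE0 := specNorm_nonneg E
  rw [key]
  calc _ ≤ specNorm E * specNorm (P * (1 + A) * P) + specNorm (Q * (1 + A) * P) * specNorm E +
        specNorm (P * ΔA * P) :=
        (specNorm_add_le _ _).trans (add_le_add_left ((specNorm_add_le _ _).trans
          (add_le_add (specNorm_mul_le _ _) (specNorm_mul_le _ _))) _)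
    _ ≤ specNorm E * ((1 + βA) * (1 + α)⁻¹) + (1 + βA) * (1 + α)⁻¹ * specNorm E +
        specNorm ΔA * (1 + α + κ)⁻¹ := by gcongr
    _ = _ := by ring
end
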